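/- arXiv:2310.09702 — 5 statements merged into one kernel-verified Lean document; each statement's English description precedes it below -/
import Mathlib

section
/- Let n ≥ 1, p ∈ [0,1], N ∼ Bin(n, p), k ≥ 1 an integer, and a_1, …, a_k ≥ 0 real. Then E[ ∏_{j=1}^k min(1, 1/(N + a_j)) ] ≤ (9k)^k ∏_{j=1}^k min(1, 1/(n p + a_j)), with the convention min(1, 1/0) = 1. -/
open MeasureTheory ProbabilityTheory Filter
open scoped ENNReal NNReal Topology

noncomputable section

/-- `min(1, 1/t)` with the convention that the value is `1` when `t = 0`. -/
def minOneInv (t : ℝ) : ℝ := if t = 0 then 1 else min 1 (1 / t)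

lemma minOneInv_eq (t : ℝ) (ht : 0 ≤ t) : minOneInv t = (max 1 t)⁻¹ := by
  unfold minOneInv
  split_ifs with h
  · simp [h]
  · have ht' : 0 < t := lt_of_le_of_ne ht (Ne.symm h)
    rcases le_total 1 t with h1 | h1
    · rw [max_eq_right h1, min_eq_right, one_div]
      rw [div_le_one ht']; exact h1
    · rw [max_eq_left h1, min_eq_left, inv_one]
      rw [le_div_iff₀ ht']; linarith

lemma ratio_bound (m : ℕ) (μ a : ℝ) (hμ : 0 ≤ μ) (ha : 0 ≤ a) :
    minOneInv ((m : ℝ) + a) ≤ (1 + 2 * μ / ((m : ℝ) + 1)) * minOneInv (μ + a) := by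
  have hm : (0 : ℝ) ≤ m := Nat.cast_nonneg m
  rw [minOneInv_eq _ (by positivity), minOneInv_eq _ (by positivity)]
  have h1 : (0 : ℝ) < max 1 ((m : ℝ) + a) := lt_max_of_lt_left one_pos
  have h2 : (0 : ℝ) < max 1 (μ + a) := lt_max_of_lt_left one_pos
  rw [← div_eq_mul_inv, le_div_iff₀ h2, inv_mul_le_iff₀ h1]
  have hx : 0 ≤ 2 * μ / ((m : ℝ) + 1) := by positivity
  have hM1 : 1 ≤ max 1 ((m : ℝ) + a) := le_max_left _ _
  have hM2 : (m : ℝ) + a ≤ max 1 ((m : ℝ) + a) := le_max_right _ _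
  have hM3 : ((m : ℝ) + 1) / 2 ≤ max 1 ((m : ℝ) + a) := by linarith
  have hM4 : a ≤ max 1 ((m : ℝ) + a) := by linarith
  apply max_le
  · nlinarith
  · have : ((m : ℝ) + 1) / 2 * (2 * μ / ((m : ℝ) + 1)) = μ := by field_simp
    nlinarith [mul_le_mul_of_nonneg_right hM3 hx]

lemma asc_le (m k i : ℕ) (hi : i ≤ k) : (m + 1).ascFactorial i ≤ (k * (m + 1)) ^ i := by
  induction i with
  | zero => simp
  | succ i ih =>
    rw [Nat.ascFactorial_succ, pow_succ, mul_comm]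
    refine Nat.mul_le_mul (ih (by omega)) ?_
    have : 1 ≤ k - i := by omega
    obtain ⟨c, rfl⟩ := Nat.exists_eq_add_of_le hi
    nlinarith [Nat.zero_le (i * m), Nat.zero_le (c * m), Nat.zero_le m, Nat.zero_le c]

lemma pow_le_asc (n i : ℕ) : n ^ i ≤ (n + 1).ascFactorial i :=
  (Nat.pow_le_pow_left (Nat.le_succ n) i).trans (Nat.pow_succ_le_ascFactorial (n + 1) i)

lemma choose_asc (n m i : ℕ) (h : m ≤ n) :
    (n + i).choose (m + i) * (m + 1).ascFactorial i = n.choose m * (n + 1).ascFactorial i := by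
  have e1 := Nat.choose_mul_factorial_mul_factorial (n := n + i) (k := m + i) (by omega)
  have e2 := Nat.choose_mul_factorial_mul_factorial h
  rw [← Nat.factorial_mul_ascFactorial, ← Nat.factorial_mul_ascFactorial, ← e2,
    Nat.add_sub_add_right] at e1
  have h1 := Nat.factorial_pos m
  have h2 := Nat.factorial_pos (n - m)
  apply Nat.eq_of_mul_eq_mul_right (Nat.mul_pos h1 h2)
  linarith

lemma moment (n : ℕ) (p : ℝ) (hp : p ∈ Set.Icc (0:ℝ) 1) (k i : ℕ) (hi : i ≤ k) :
    ∑ m ∈ Finset.range (n + 1),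
      (n.choose m : ℝ) * p ^ m * (1 - p) ^ (n - m) * ((n : ℝ) * p / ((m : ℝ) + 1)) ^ i
      ≤ (k : ℝ) ^ i := by
  obtain ⟨hp0, hp1⟩ := hp
  have hq : 0 ≤ 1 - p := by linarith
  have key : ∀ m ∈ Finset.range (n + 1),
      (n.choose m : ℝ) * p ^ m * (1 - p) ^ (n - m) * ((n : ℝ) * p / ((m : ℝ) + 1)) ^ i
      ≤ (k : ℝ) ^ i * (p ^ (m + i) * (1 - p) ^ (n + i - (m + i)) * ((n + i).choose (m + i))) := by
    intro m hm
    have hm' : m ≤ n := by simpa [Nat.lt_succ_iff] using hm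
    have A : (((m + 1).ascFactorial i : ℕ) : ℝ) ≤ (k : ℝ) ^ i * ((m : ℝ) + 1) ^ i := by
      have := asc_le m k i hi
      rw [mul_pow] at this
      exact_mod_cast this
    have B : (n : ℝ) ^ i ≤ (((n + 1).ascFactorial i : ℕ) : ℝ) := by exact_mod_cast pow_le_asc n i
    have C : ((n + i).choose (m + i) : ℝ) * (((m + 1).ascFactorial i : ℕ) : ℝ)
        = n.choose m * (((n + 1).ascFactorial i : ℕ) : ℝ) := by exact_mod_cast choose_asc n m i hm'
    have D : (n.choose m : ℝ) * (n : ℝ) ^ i / ((m : ℝ) + 1) ^ i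
        ≤ (k : ℝ) ^ i * ((n + i).choose (m + i)) := by
      rw [div_le_iff₀ (by positivity)]
      calc (n.choose m : ℝ) * (n : ℝ) ^ i ≤ n.choose m * (((n + 1).ascFactorial i : ℕ) : ℝ) := by
            gcongr
        _ = ((n + i).choose (m + i) : ℝ) * (((m + 1).ascFactorial i : ℕ) : ℝ) := C.symm
        _ ≤ ((n + i).choose (m + i) : ℝ) * ((k : ℝ) ^ i * ((m : ℝ) + 1) ^ i) := by gcongr
        _ = _ := by ring
    rw [Nat.add_sub_add_right]
    have E : 0 ≤ p ^ (m + i) * (1 - p) ^ (n - m) := by positivity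
    calc _ = (p ^ (m + i) * (1 - p) ^ (n - m)) *
          ((n.choose m : ℝ) * (n : ℝ) ^ i / ((m : ℝ) + 1) ^ i) := by
            rw [div_pow, mul_pow, pow_add]; ring
      _ ≤ _ := mul_le_mul_of_nonneg_left D E
      _ = _ := by ring
  refine (Finset.sum_le_sum key).trans ?_
  rw [← Finset.mul_sum]
  refine mul_le_of_le_one_right (by positivity) ?_
  have T := add_pow p (1 - p) (n + i)
  rw [show n + i + 1 = i + (n + 1) by omega, Finset.sum_range_add] at T
  have P : 0 ≤ ∑ x ∈ Finset.range i, p ^ x * (1 - p) ^ (n + i - x) * ((n + i).choose x : ℝ) :=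
    Finset.sum_nonneg fun x _ => by positivity
  have T1 : (p + (1 - p)) ^ (n + i) = 1 := by simp
  simp only [add_comm i] at T
  linarith

theorem binomial_inverse_moment_bound
    (n : ℕ) (hn : 1 ≤ n) (p : ℝ) (hp : p ∈ Set.Icc (0:ℝ) 1)
    (k : ℕ) (hk : 1 ≤ k) (a : Fin k → ℝ) (ha : ∀ j, 0 ≤ a j) :
    ∑ m ∈ Finset.range (n + 1),
        (n.choose m : ℝ) * p ^ m * (1 - p) ^ (n - m) * ∏ j, minOneInv ((m : ℝ) + a j)
      ≤ (9 * k : ℝ) ^ k * ∏ j, minOneInv ((n : ℝ) * p + a j) := by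
  have hp0 := hp.1
  have hq : 0 ≤ 1 - p := by linarith [hp.2]
  have hμ : 0 ≤ (n : ℝ) * p := by positivity
  have hnn : ∀ t : ℝ, 0 ≤ t → 0 ≤ minOneInv t := fun t ht => by
    rw [minOneInv_eq t ht]; positivity
  have hk1 : (1 : ℝ) ≤ k := by exact_mod_cast hk
  have hP : 0 ≤ ∏ j, minOneInv ((n : ℝ) * p + a j) :=
    Finset.prod_nonneg fun j _ => hnn _ (add_nonneg hμ (ha j))
  have key : ∀ m ∈ Finset.range (n + 1),
      (n.choose m : ℝ) * p ^ m * (1 - p) ^ (n - m) * ∏ j, minOneInv ((m : ℝ) + a j) ≤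
      ((n.choose m : ℝ) * p ^ m * (1 - p) ^ (n - m) *
        (2 * ((n : ℝ) * p / ((m : ℝ) + 1)) + 1) ^ k) * ∏ j, minOneInv ((n : ℝ) * p + a j) := by
    intro m _
    rw [mul_assoc _ (_ ^ k)]
    refine mul_le_mul_of_nonneg_left ?_ (by positivity)
    calc _ ≤ ∏ j, ((1 + 2 * ((n : ℝ) * p) / ((m : ℝ) + 1)) * minOneInv ((n : ℝ) * p + a j)) :=
          Finset.prod_le_prod (fun j _ => hnn _ (add_nonneg (Nat.cast_nonneg m) (ha j)))
            fun j _ => ratio_bound m _ _ hμ (ha j)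
      _ = _ := by
          rw [Finset.prod_mul_distrib, Finset.prod_const, Finset.card_univ, Fintype.card_fin]
          congr 2; ring
  refine (Finset.sum_le_sum key).trans ?_
  rw [← Finset.sum_mul]
  refine mul_le_mul_of_nonneg_right ?_ hP
  calc _ = ∑ i ∈ Finset.range (k + 1), 2 ^ i * (k.choose i : ℝ) * ∑ m ∈ Finset.range (n + 1),
      (n.choose m : ℝ) * p ^ m * (1 - p) ^ (n - m) * ((n : ℝ) * p / ((m : ℝ) + 1)) ^ i := by
        simp only [add_pow, Finset.mul_sum]
        rw [Finset.sum_comm]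
        refine Finset.sum_congr rfl fun i _ => Finset.sum_congr rfl fun m _ => ?_
        rw [mul_pow, one_pow]; ring
    _ ≤ ∑ i ∈ Finset.range (k + 1), 2 ^ i * (k.choose i : ℝ) * (k : ℝ) ^ i := by
        refine Finset.sum_le_sum fun i hi => mul_le_mul_of_nonneg_left ?_ (by positivity)
        exact moment n p hp k i (by simpa [Nat.lt_succ_iff] using hi)
    _ = (2 * (k : ℝ) + 1) ^ k := by
        rw [add_pow]
        refine Finset.sum_congr rfl fun i _ => ?_
        rw [mul_pow, one_pow]; ring
    _ ≤ _ := by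
        refine pow_le_pow_left₀ (by positivity) ?_ k
        linarith
end
end

section
/- Let n ≥ 1, p ∈ [0,1], N ∼ Bin(n, p), and a ≥ 1 real. Then 0 ≤ E[ 1/(N + a) ] − 1/(n p + a) ≤ 2^{19} / (n p + a)². -/
open MeasureTheory ProbabilityTheory Filter
open scoped ENNReal NNReal Topology

noncomputable section

lemma aux_S0 (n : ℕ) (p : ℝ) : ∑ m ∈ Finset.range (n + 1),
    (n.choose m : ℝ) * p ^ m * (1 - p) ^ (n - m) = 1 := by
  have h := add_pow p (1 - p) n
  rw [add_sub_cancel, one_pow] at h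
  refine Eq.trans ?_ h.symm
  exact Finset.sum_congr rfl fun m _ => by ring

lemma aux_S1 (n : ℕ) (p : ℝ) : ∑ m ∈ Finset.range (n + 1),
    (n.choose m : ℝ) * p ^ m * (1 - p) ^ (n - m) * (m : ℝ) = n * p := by
  have h := congrArg (Polynomial.eval p) (bernsteinPolynomial.sum_smul ℝ n)
  simp only [Polynomial.eval_finsetSum, bernsteinPolynomial, nsmul_eq_mul, Polynomial.eval_mul,
    Polynomial.eval_natCast, Polynomial.eval_pow, Polynomial.eval_sub, Polynomial.eval_one,
    Polynomial.eval_X] at h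
  rw [← h]
  exact Finset.sum_congr rfl fun m _ => by ring

lemma aux_Sinv (n : ℕ) (p : ℝ) (h0 : 0 ≤ 1 - p) : ((n : ℝ) * p + p) * ∑ m ∈ Finset.range (n + 1),
    (n.choose m : ℝ) * p ^ m * (1 - p) ^ (n - m) * (1 / ((m : ℝ) + 1)) ≤ 1 := by
  have h := aux_S0 (n + 1) p
  rw [Finset.sum_range_succ'] at h
  have h2 : ((n : ℝ) * p + p) * ∑ m ∈ Finset.range (n + 1),
    (n.choose m : ℝ) * p ^ m * (1 - p) ^ (n - m) * (1 / ((m : ℝ) + 1)) =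
    ∑ k ∈ Finset.range (n + 1), ((n + 1).choose (k + 1) : ℝ) * p ^ (k + 1) *
      (1 - p) ^ (n + 1 - (k + 1)) := by
    rw [Finset.mul_sum]
    refine Finset.sum_congr rfl fun m _ => ?_
    have e : ((n : ℝ) + 1) * (n.choose m : ℝ) = ((n + 1).choose (m + 1) : ℝ) * ((m : ℝ) + 1) := by
      exact_mod_cast Nat.add_one_mul_choose_eq n m
    have hm : ((m : ℝ) + 1) ≠ 0 := by positivity
    rw [Nat.add_sub_add_right]
    field_simp
    linear_combination p ^ (m + 1) * (1 - p) ^ (n - m) * e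
  have h3 : 0 ≤ (1 - p) ^ (n + 1) := by positivity
  simp only [Nat.choose_zero_right, Nat.cast_one, pow_zero, mul_one, one_mul, Nat.sub_zero] at h
  linarith

lemma aux_V (n : ℕ) (p : ℝ) (hp0 : 0 ≤ p) (hp1 : 0 ≤ 1 - p) : ∑ m ∈ Finset.range (n + 1),
    (n.choose m : ℝ) * p ^ m * (1 - p) ^ (n - m) * (((m : ℝ) - n * p) ^ 2 / ((m : ℝ) + 1)) ≤ 2 := by
  have e : ∑ m ∈ Finset.range (n + 1),
      (n.choose m : ℝ) * p ^ m * (1 - p) ^ (n - m) * (((m : ℝ) - n * p) ^ 2 / ((m : ℝ) + 1)) =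
      n * p + (1 - 2 * (n * p + 1)) + (n * p + 1) ^ 2 * ∑ m ∈ Finset.range (n + 1),
      (n.choose m : ℝ) * p ^ m * (1 - p) ^ (n - m) * (1 / ((m : ℝ) + 1)) := by
    have e0 : (1 - 2 * ((n : ℝ) * p + 1)) = (1 - 2 * ((n : ℝ) * p + 1)) *
      ∑ m ∈ Finset.range (n + 1), (n.choose m : ℝ) * p ^ m * (1 - p) ^ (n - m) := by
      rw [aux_S0, mul_one]
    rw [e0]
    refine Eq.trans ?_ (congrArg (fun t => t + _ + _) (aux_S1 n p))
    simp only [Finset.mul_sum]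
    rw [← Finset.sum_add_distrib, ← Finset.sum_add_distrib]
    refine Finset.sum_congr rfl fun m _ => ?_
    have hm : ((m : ℝ) + 1) ≠ 0 := by positivity
    field_simp
    ring
  rw [e]
  have hi := aux_Sinv n p hp1
  have hle : ∑ m ∈ Finset.range (n + 1),
      (n.choose m : ℝ) * p ^ m * (1 - p) ^ (n - m) * (1 / ((m : ℝ) + 1)) ≤ 1 := by
    refine le_of_le_of_eq (Finset.sum_le_sum fun m _ => ?_) (aux_S0 n p)
    refine mul_le_of_le_one_right (by positivity) ?_
    rw [div_le_one (by positivity)]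
    have : (0 : ℝ) ≤ m := by positivity
    linarith
  set T := ∑ m ∈ Finset.range (n + 1),
      (n.choose m : ℝ) * p ^ m * (1 - p) ^ (n - m) * (1 / ((m : ℝ) + 1))
  have hu : 0 ≤ (n : ℝ) * p := by positivity
  set u := (n : ℝ) * p
  rcases le_total u 1 with h | h
  · nlinarith [mul_le_mul_of_nonneg_left hle (sq_nonneg (u + 1))]
  · have hT : T ≤ 1 / u := by
      rw [le_div_iff₀ (by linarith)]
      have hT0 : 0 ≤ T := Finset.sum_nonneg fun m _ => by positivity
      nlinarith
    have : (u + 1) ^ 2 * T ≤ u + 2 + 1 := by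
      refine (mul_le_mul_of_nonneg_left hT (sq_nonneg _)).trans ?_
      rw [mul_one_div, div_le_iff₀ (by linarith)]
      nlinarith
    linarith

/-- Lemma 7, first part: expectation inequality for the binomial
distribution. For `N ∼ Bin(n, p)` and `a ≥ 1`,
`0 ≤ E[1/(N+a)] − 1/(np+a) ≤ 2^19/(np+a)²`; the expectation over the binomial law is
written as the explicit finite sum `∑_{m=0}^n C(n,m) p^m (1-p)^{n-m} (⋯)`. -/
theorem binomial_first_inverse_moment
    (n : ℕ) (hn : 1 ≤ n) (p : ℝ) (hp : p ∈ Set.Icc (0:ℝ) 1) (a : ℝ) (ha : 1 ≤ a) :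
    0 ≤ (∑ m ∈ Finset.range (n + 1),
          (n.choose m : ℝ) * p ^ m * (1 - p) ^ (n - m) * (1 / ((m : ℝ) + a)))
        - 1 / ((n : ℝ) * p + a) ∧
    (∑ m ∈ Finset.range (n + 1),
          (n.choose m : ℝ) * p ^ m * (1 - p) ^ (n - m) * (1 / ((m : ℝ) + a)))
        - 1 / ((n : ℝ) * p + a) ≤ 2 ^ 19 / ((n : ℝ) * p + a) ^ 2 := by
  obtain ⟨hp0, hp1⟩ := hp
  have hq : 0 ≤ 1 - p := by linarith
  have hu : 0 ≤ (n : ℝ) * p := by positivity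
  have hM : 0 < (n : ℝ) * p + a := by linarith
  have key : (∑ m ∈ Finset.range (n + 1),
          (n.choose m : ℝ) * p ^ m * (1 - p) ^ (n - m) * (1 / ((m : ℝ) + a)))
        - 1 / ((n : ℝ) * p + a) = (∑ m ∈ Finset.range (n + 1),
      (n.choose m : ℝ) * p ^ m * (1 - p) ^ (n - m) * (((m : ℝ) - n * p) ^ 2 / ((m : ℝ) + a)))
        / ((n : ℝ) * p + a) ^ 2 := by
    have e : (∑ m ∈ Finset.range (n + 1),
      (n.choose m : ℝ) * p ^ m * (1 - p) ^ (n - m) * (((m : ℝ) - n * p) ^ 2 / ((m : ℝ) + a)))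
      = (∑ m ∈ Finset.range (n + 1), (n.choose m : ℝ) * p ^ m * (1 - p) ^ (n - m) * (m : ℝ))
      + (a - 2 * (n * p + a)) *
        (∑ m ∈ Finset.range (n + 1), (n.choose m : ℝ) * p ^ m * (1 - p) ^ (n - m))
      + (n * p + a) ^ 2 * (∑ m ∈ Finset.range (n + 1),
          (n.choose m : ℝ) * p ^ m * (1 - p) ^ (n - m) * (1 / ((m : ℝ) + a))) := by
      simp only [Finset.mul_sum]
      rw [← Finset.sum_add_distrib, ← Finset.sum_add_distrib]
      refine Finset.sum_congr rfl fun m _ => ?_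
      have hm : ((m : ℝ) + a) ≠ 0 := by positivity
      field_simp
      ring
    rw [e, aux_S0, aux_S1]
    field_simp
    ring
  rw [key]
  have hle := aux_V n p hp0 hq
  refine ⟨div_nonneg (Finset.sum_nonneg fun m _ => by positivity) (by positivity), ?_⟩
  refine div_le_div_of_nonneg_right ?_ (by positivity)
  refine le_trans (Finset.sum_le_sum fun m _ => ?_) (hle.trans (by norm_num))
  gcongr
end
end

section
/- Let n ≥ 1, p ∈ [0,1], N ∼ Bin(n, p), and a, b ≥ 1 real. Then 0 ≤ E[ 1/((N + a)(N + b)) ] − 1/((n p + a)(n p + b)) ≤ ( 2^{27} / ((n p + a)(n p + b)) ) · ( 1/(n p + a) + 1/(n p + b) ). -/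
open MeasureTheory ProbabilityTheory Filter
open scoped ENNReal NNReal Topology

noncomputable section

def wt (n : ℕ) (p : ℝ) (m : ℕ) : ℝ := (n.choose m : ℝ) * p ^ m * (1 - p) ^ (n - m)

lemma wt_nonneg (n : ℕ) (p : ℝ) (hp : p ∈ Set.Icc (0:ℝ) 1) (m : ℕ) : 0 ≤ wt n p m := by
  have h1 := hp.1
  have h2 : 0 ≤ 1 - p := by linarith [hp.2]
  unfold wt; positivity

lemma wt_bern (n : ℕ) (p : ℝ) (m : ℕ) : (bernsteinPolynomial ℝ n m).eval p = wt n p m := by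
  simp [bernsteinPolynomial, wt]

lemma wt_sum (n : ℕ) (p : ℝ) : ∑ m ∈ Finset.range (n+1), wt n p m = 1 := by
  have h := congrArg (Polynomial.eval p) (bernsteinPolynomial.sum ℝ n)
  simpa [Polynomial.eval_finset_sum, wt_bern] using h

lemma wt_mean (n : ℕ) (p : ℝ) : ∑ m ∈ Finset.range (n+1), wt n p m * ((m:ℝ) - n * p) = 0 := by
  have h := congrArg (Polynomial.eval p) (bernsteinPolynomial.sum_smul ℝ n)
  simp [Polynomial.eval_finset_sum, wt_bern] at h
  have h2 := wt_sum n p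
  simp only [mul_sub, Finset.sum_sub_distrib, ← Finset.sum_mul, h2]
  rw [← sub_eq_zero] at h
  rw [← h]
  simp [mul_comm]

lemma wt_var (n : ℕ) (p : ℝ) :
    ∑ m ∈ Finset.range (n+1), wt n p m * ((m:ℝ) - n * p)^2 = n * p * (1 - p) := by
  have h := congrArg (Polynomial.eval p) (bernsteinPolynomial.variance ℝ n)
  simp [Polynomial.eval_finset_sum, wt_bern] at h
  rw [← h]
  apply Finset.sum_congr rfl
  intros; ring

lemma wt_exp (n : ℕ) (p : ℝ) (hp : p ∈ Set.Icc (0:ℝ) 1) :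
    ∑ m ∈ Finset.range (n+1), wt n p m * Real.exp (-(m:ℝ)) ≤ Real.exp (-(n * p * (5/8))) := by
  have h1 : ∑ m ∈ Finset.range (n+1), wt n p m * Real.exp (-(m:ℝ))
      = (p * Real.exp (-1) + (1 - p))^n := by
    rw [add_pow]
    apply Finset.sum_congr rfl
    intro m _
    have : Real.exp (-(m:ℝ)) = Real.exp (-1) ^ m := by
      rw [← Real.exp_nat_mul]; congr 1; ring
    rw [this, mul_pow, wt]; ring
  rw [h1]
  have h3 : Real.exp (-(n * p * (5/8))) = Real.exp (-(p * (5/8)))^n := by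
    rw [← Real.exp_nat_mul]; congr 1; ring
  rw [h3]
  have h4 : Real.exp (-1) ≤ 3/8 := by
    have := Real.exp_neg_one_lt_d9
    linarith
  have hp1 := hp.1
  have hp2 := hp.2
  apply pow_le_pow_left₀
  · have := Real.exp_pos (-1)
    nlinarith [mul_nonneg hp1 this.le]
  · have := Real.add_one_le_exp (-(p * (5/8)))
    nlinarith

lemma wt_tail (n : ℕ) (p : ℝ) (hp : p ∈ Set.Icc (0:ℝ) 1) (c : ℝ) (hc : 1 ≤ c) :
    ∑ m ∈ Finset.range (n+1), wt n p m *
      Real.exp ((n * p + c)/2 - (m + c)) ≤ 3072 / (n * p + c)^3 := by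
  have hnp : 0 ≤ n * p := mul_nonneg (Nat.cast_nonneg n) hp.1
  have h1 : ∑ m ∈ Finset.range (n+1), wt n p m * Real.exp ((n * p + c)/2 - (m + c))
      = Real.exp ((n * p + c)/2 - c) * ∑ m ∈ Finset.range (n+1), wt n p m * Real.exp (-(m:ℝ)) := by
    rw [Finset.mul_sum]
    apply Finset.sum_congr rfl
    intro m _
    rw [show (n * p + c)/2 - (m + c) = ((n * p + c)/2 - c) + (-(m:ℝ)) by ring, Real.exp_add]
    ring
  rw [h1]
  have h2 : Real.exp ((n * p + c)/2 - c) * ∑ m ∈ Finset.range (n+1), wt n p m * Real.exp (-(m:ℝ))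
      ≤ Real.exp ((n * p + c)/2 - c) * Real.exp (-(n * p * (5/8))) :=
    mul_le_mul_of_nonneg_left (wt_exp n p hp) (Real.exp_pos _).le
  refine h2.trans ?_
  rw [← Real.exp_add]
  set C := n * p + c with hC
  have hC0 : 0 < C := by linarith
  have h3 : Real.exp (C/2 - c + -(n * p * (5/8))) ≤ Real.exp (-(C/8)) := by
    apply Real.exp_le_exp.mpr; linarith
  refine h3.trans ?_
  rw [Real.exp_neg, inv_eq_one_div, div_le_div_iff₀ (Real.exp_pos _) (by positivity)]
  have h4 := Real.pow_div_factorial_le_exp (C/8) (by positivity) 3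
  norm_num [Nat.factorial] at h4
  nlinarith

lemma pt_bound (u C : ℝ) (hu : 1 ≤ u) (hC : 1 ≤ C) :
    (u - C)^2 / u ≤ 2/C * (u - C)^2 + C^2 * Real.exp (C/2 - u) ∧
    (u - C)^2 / u^2 ≤ 4/C^2 * (u - C)^2 + C^2 * Real.exp (C/2 - u) := by
  have hu0 : 0 < u := by linarith
  have hC0 : 0 < C := by linarith
  have he := Real.exp_pos (C/2 - u)
  rcases le_or_gt (C/2) u with h | h
  · have h1 : 1/u ≤ 2/C := by
      rw [div_le_div_iff₀ hu0 hC0]; linarith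
    have h2 : 1/u^2 ≤ 4/C^2 := by
      rw [div_le_div_iff₀ (by positivity) (by positivity)]; nlinarith
    have h3 := mul_le_mul_of_nonneg_right h1 (sq_nonneg (u - C))
    have h4 := mul_le_mul_of_nonneg_right h2 (sq_nonneg (u - C))
    have h5 : 0 ≤ C^2 * Real.exp (C/2 - u) := by positivity
    constructor
    · calc _ = 1/u * (u-C)^2 := by ring
        _ ≤ _ := by linarith
    · calc _ = 1/u^2 * (u-C)^2 := by ring
        _ ≤ _ := by linarith
  · have h1 : 1 ≤ Real.exp (C/2 - u) := Real.one_le_exp (by linarith)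
    have h2 : (u - C)^2 ≤ C^2 := by nlinarith
    have h3 : C^2 ≤ C^2 * Real.exp (C/2 - u) := le_mul_of_one_le_right (by positivity) h1
    have h4 : (u - C)^2/u ≤ (u-C)^2 := div_le_self (by positivity) hu
    have h5 : (u - C)^2/u^2 ≤ (u-C)^2 := div_le_self (by positivity) (one_le_pow₀ hu)
    have h6 : 0 ≤ 2/C * (u - C)^2 := by positivity
    have h7 : 0 ≤ 4/C^2 * (u - C)^2 := by positivity
    constructor <;> linarith

lemma key (n : ℕ) (p : ℝ) (hp : p ∈ Set.Icc (0:ℝ) 1) (c : ℝ) (hc : 1 ≤ c) :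
    ∑ m ∈ Finset.range (n+1), wt n p m * (((m:ℝ) - n * p)^2 / (m + c)) ≤ 3074 ∧
    ∑ m ∈ Finset.range (n+1), wt n p m * (((m:ℝ) - n * p)^2 / (m + c)^2)
      ≤ 3076 * (1 / (n * p + c)) := by
  have hnp : 0 ≤ n * p := mul_nonneg (Nat.cast_nonneg n) hp.1
  have ht := wt_tail n p hp c hc
  have hv : ∑ m ∈ Finset.range (n+1), wt n p m * ((m:ℝ) - n * p)^2 ≤ n * p + c := by
    rw [wt_var]; nlinarith [mul_nonneg hnp hp.1]
  set C := n * p + c with hC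
  have hC1 : 1 ≤ C := by linarith
  have hC0 : 0 < C := by linarith
  have hlin : ∀ k : ℝ, ∑ m ∈ Finset.range (n+1), wt n p m *
      (k * ((m:ℝ) - n * p)^2 + C^2 * Real.exp (C/2 - (m + c)))
      = k * ∑ m ∈ Finset.range (n+1), wt n p m * ((m:ℝ) - n * p)^2
       + C^2 * ∑ m ∈ Finset.range (n+1), wt n p m * Real.exp (C/2 - (m + c)) := by
    intro k
    rw [Finset.mul_sum, Finset.mul_sum, ← Finset.sum_add_distrib]
    apply Finset.sum_congr rfl
    intros; ring
  have hb : ∀ k : ℝ, 0 ≤ k → ∑ m ∈ Finset.range (n+1), wt n p m *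
      (k * ((m:ℝ) - n * p)^2 + C^2 * Real.exp (C/2 - (m + c))) ≤ k * C + 3072 * (1 / C) := by
    intro k hk
    rw [hlin]
    have h1 := mul_le_mul_of_nonneg_left hv hk
    have h2 := mul_le_mul_of_nonneg_left ht (sq_nonneg C)
    have h3 : C^2 * (3072 / C^3) = 3072 * (1/C) := by field_simp
    linarith
  have hpt : ∀ m : ℕ, _ := fun m => pt_bound ((m:ℝ) + c) C
    (by have : (0:ℝ) ≤ m := Nat.cast_nonneg m
        linarith) hC1
  have hd : ∀ m : ℕ, (m:ℝ) + c - C = m - n * p := by intro m; rw [hC]; ring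
  simp only [hd] at hpt
  have hCi : 1 / C ≤ 1 := by rw [div_le_one hC0]; exact hC1
  constructor
  · refine (Finset.sum_le_sum fun m _ =>
      mul_le_mul_of_nonneg_left (hpt m).1 (wt_nonneg n p hp m)).trans ?_
    refine (hb (2/C) (by positivity)).trans ?_
    have : 2 / C * C = 2 := by field_simp
    linarith
  · refine (Finset.sum_le_sum fun m _ =>
      mul_le_mul_of_nonneg_left (hpt m).2 (wt_nonneg n p hp m)).trans ?_
    refine (hb (4/C^2) (by positivity)).trans ?_
    have : 4 / C^2 * C = 4 * (1/C) := by field_simp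
    linarith

lemma rem_eq (u v A B d : ℝ) (hu : 0 < u) (hv : 0 < v) (hA : 0 < A) (hB : 0 < B)
    (h1 : u = A + d) (h2 : v = B + d) :
    1/(u*v) = 1/(A*B) - 1/(A*B)*(1/A+1/B) * d
      + 1/(A*B) * (1/A * (d^2/u) + 1/B * (d^2/v) + d^2/(u*v)) := by
  have hA' : A = u - d := by linarith
  have hB' : B = v - d := by linarith
  field_simp
  subst h1 h2
  ring

lemma amgm (u v d : ℝ) (hu : 0 < u) (hv : 0 < v) :
    d^2/(u*v) ≤ d^2/u^2 + d^2/v^2 := by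
  have : d^2/(u*v) = (d/u)*(d/v) := by field_simp
  rw [this, ← div_pow, ← div_pow]
  nlinarith [sq_nonneg (d/u - d/v), sq_nonneg (d/u), sq_nonneg (d/v)]

/-- Lemma 7, second part: expectation inequality for the binomial
distribution. For `N ∼ Bin(n, p)` and `a, b ≥ 1`,
`0 ≤ E[1/((N+a)(N+b))] − 1/((np+a)(np+b))
  ≤ (2^27/((np+a)(np+b))) (1/(np+a) + 1/(np+b))`; the expectation over the binomial law is
written as the explicit finite sum `∑_{m=0}^n C(n,m) p^m (1-p)^{n-m} (⋯)`. -/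
theorem binomial_second_inverse_moment
    (n : ℕ) (hn : 1 ≤ n) (p : ℝ) (hp : p ∈ Set.Icc (0:ℝ) 1) (a b : ℝ)
    (ha : 1 ≤ a) (hb : 1 ≤ b) :
    0 ≤ (∑ m ∈ Finset.range (n + 1),
          (n.choose m : ℝ) * p ^ m * (1 - p) ^ (n - m)
            * (1 / (((m : ℝ) + a) * ((m : ℝ) + b))))
        - 1 / (((n : ℝ) * p + a) * ((n : ℝ) * p + b)) ∧
    (∑ m ∈ Finset.range (n + 1),
          (n.choose m : ℝ) * p ^ m * (1 - p) ^ (n - m)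
            * (1 / (((m : ℝ) + a) * ((m : ℝ) + b))))
        - 1 / (((n : ℝ) * p + a) * ((n : ℝ) * p + b))
      ≤ 2 ^ 27 / (((n : ℝ) * p + a) * ((n : ℝ) * p + b))
          * (1 / ((n : ℝ) * p + a) + 1 / ((n : ℝ) * p + b)) := by
  have hnp : 0 ≤ n * p := mul_nonneg (Nat.cast_nonneg n) hp.1
  obtain ⟨ha1, ha2⟩ := key n p hp a ha
  obtain ⟨hb1, hb2⟩ := key n p hp b hb
  set A := n * p + a with hA
  set B := n * p + b with hB
  have hA0 : 0 < A := by linarith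
  have hB0 : 0 < B := by linarith
  have hua : ∀ m : ℕ, 0 < (m:ℝ) + a := fun m => by positivity
  have hub : ∀ m : ℕ, 0 < (m:ℝ) + b := fun m => by positivity
  let R : ℕ → ℝ := fun m => 1/A * (((m:ℝ) - n * p)^2/(m+a)) + 1/B * (((m:ℝ) - n * p)^2/(m+b))
      + ((m:ℝ) - n * p)^2/((m+a)*(m+b))
  have hsum : (∑ m ∈ Finset.range (n + 1),
          (n.choose m : ℝ) * p ^ m * (1 - p) ^ (n - m)
            * (1 / (((m : ℝ) + a) * ((m : ℝ) + b)))) - 1 / (A * B)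
      = 1/(A*B) * ∑ m ∈ Finset.range (n+1), wt n p m * R m := by
    have e : (∑ m ∈ Finset.range (n + 1),
          (n.choose m : ℝ) * p ^ m * (1 - p) ^ (n - m)
            * (1 / (((m : ℝ) + a) * ((m : ℝ) + b))))
        = 1/(A*B) * ∑ m ∈ Finset.range (n+1), wt n p m
          - 1/(A*B)*(1/A+1/B) * ∑ m ∈ Finset.range (n+1), wt n p m * ((m:ℝ) - n * p)
          + 1/(A*B) * ∑ m ∈ Finset.range (n+1), wt n p m * R m := by
      rw [Finset.mul_sum, Finset.mul_sum, Finset.mul_sum, ← Finset.sum_sub_distrib,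
        ← Finset.sum_add_distrib]
      apply Finset.sum_congr rfl
      intro m _
      rw [rem_eq ((m:ℝ)+a) (m+b) A B (m - n * p) (hua m) (hub m) hA0 hB0
        (by rw [hA]; ring) (by rw [hB]; ring)]
      simp only [R, wt]
      ring
    rw [e, wt_sum, wt_mean]; ring
  have hAB : 0 ≤ 1/(A*B) := by positivity
  rw [hsum]
  constructor
  · apply mul_nonneg hAB
    apply Finset.sum_nonneg
    intro m _
    apply mul_nonneg (wt_nonneg n p hp m)
    have := hua m
    have := hub m
    positivity
  · have hR : ∑ m ∈ Finset.range (n+1), wt n p m * R m ≤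
        1/A * ∑ m ∈ Finset.range (n+1), wt n p m * (((m:ℝ) - n * p)^2 / (m + a))
        + 1/B * ∑ m ∈ Finset.range (n+1), wt n p m * (((m:ℝ) - n * p)^2 / (m + b))
        + ∑ m ∈ Finset.range (n+1), wt n p m * (((m:ℝ) - n * p)^2 / (m + a)^2)
        + ∑ m ∈ Finset.range (n+1), wt n p m * (((m:ℝ) - n * p)^2 / (m + b)^2) := by
      rw [Finset.mul_sum, Finset.mul_sum, ← Finset.sum_add_distrib,
        ← Finset.sum_add_distrib, ← Finset.sum_add_distrib]
      apply Finset.sum_le_sum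
      intro m _
      have h := mul_le_mul_of_nonneg_left
        (amgm ((m:ℝ)+a) (m+b) (m - n * p) (hua m) (hub m)) (wt_nonneg n p hp m)
      simp only [R]
      linarith
    have hA1 : 0 ≤ 1/A := by positivity
    have hB1 : 0 ≤ 1/B := by positivity
    have h1 := mul_le_mul_of_nonneg_left ha1 hA1
    have h2 := mul_le_mul_of_nonneg_left hb1 hB1
    have h3 : ∑ m ∈ Finset.range (n+1), wt n p m * R m ≤ 2^27 * (1/A + 1/B) := by
      linarith
    calc _ ≤ 1/(A*B) * (2^27 * (1/A + 1/B)) := mul_le_mul_of_nonneg_left h3 hAB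
      _ = _ := by ring
end
end

section
/- Let E_1, E_2 be i.i.d. Exponential(1) random variables and let ν be a nonnegative integer. Then E[ (E_1^{2ν+1} + E_2^{2ν+1}) / (E_1 + E_2) ] = (2ν + 1)! / (ν + 1). -/
open MeasureTheory ProbabilityTheory Filter
open scoped ENNReal NNReal Topology

noncomputable section

/-- A standard Exponential(1) random variable: `P(E > t) = e^{-t}` for all `t ≥ 0`. -/
def IsExpOne {Ω : Type*} [MeasurableSpace Ω] (P : Measure Ω) (E : Ω → ℝ) : Prop :=
  Measurable E ∧ ∀ t : ℝ, 0 ≤ t → P {ω | t < E ω} = ENNReal.ofReal (Real.exp (-t))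

lemma aux_sum (n : ℕ) :
    ((n : ℝ) + 2) * ∑ k ∈ Finset.range (n + 1),
      (-1 : ℝ) ^ k * ((Nat.factorial k : ℝ) * (Nat.factorial (n - k) : ℝ))
      = (Nat.factorial (n + 1) : ℝ) * (1 + (-1) ^ n) := by
  have key : ∀ k ∈ Finset.range (n + 1),
      ((n : ℝ) + 2) * ((-1 : ℝ) ^ k * ((Nat.factorial k : ℝ) * (Nat.factorial (n - k) : ℝ)))
      = (-1 : ℝ) ^ k * ((Nat.factorial k : ℝ) * (Nat.factorial (n + 1 - k) : ℝ))
        - (-1 : ℝ) ^ (k + 1) *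
          ((Nat.factorial (k + 1) : ℝ) * (Nat.factorial (n + 1 - (k + 1)) : ℝ)) := by
    intro k hk
    obtain ⟨m, rfl⟩ : ∃ m, n = k + m := ⟨n - k, by simp at hk; omega⟩
    have e1 : k + m - k = m := by omega
    have e2 : k + m + 1 - k = m + 1 := by omega
    have e3 : k + m + 1 - (k + 1) = m := by omega
    rw [e1, e2, e3, Nat.factorial_succ, Nat.factorial_succ]
    push_cast
    ring
  rw [Finset.mul_sum, Finset.sum_congr rfl key,
    Finset.sum_range_sub' (fun k => (-1 : ℝ) ^ k *
      ((Nat.factorial k : ℝ) * (Nat.factorial (n + 1 - k) : ℝ)))]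
  simp
  ring

lemma aux_map {Ω : Type*} [MeasurableSpace Ω] (P : Measure Ω) [IsProbabilityMeasure P]
    (E : Ω → ℝ) (h : IsExpOne P E) : P.map E = expMeasure 1 := by
  obtain ⟨hm, ht⟩ := h
  haveI := isProbabilityMeasure_expMeasure (r := 1) one_pos
  haveI : IsProbabilityMeasure (P.map E) := Measure.isProbabilityMeasure_map hm.aemeasurable
  have hc : ∀ t : ℝ, 0 ≤ t → (P.map E).real (Set.Iic t) = 1 - Real.exp (-t) := by
    intro t h0
    have : (P.map E).real (Set.Iic t)ᶜ = Real.exp (-t) := by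
      rw [Set.compl_Iic, measureReal_def, Measure.map_apply hm measurableSet_Ioi]
      have := ht t h0
      change (P {ω | t < E ω}).toReal = _
      rw [this, ENNReal.toReal_ofReal (Real.exp_pos _).le]
    rw [probReal_compl_eq_one_sub measurableSet_Iic] at this
    linarith
  apply Measure.eq_of_cdf
  ext x
  rw [cdf_expMeasure_eq one_pos, cdf_eq_real]
  split_ifs with hx
  · rw [hc x hx, one_mul]
  · apply le_antisymm _ measureReal_nonneg
    have h0 := hc 0 le_rfl
    simp only [neg_zero, Real.exp_zero, sub_self] at h0
    rw [← h0]
    exact measureReal_mono (Set.Iic_subset_Iic.2 (by linarith))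

lemma aux_dens (k : ℕ) : (fun x : ℝ => x ^ k * (gammaPDF 1 1 x).toReal)
    = Set.indicator (Set.Ici 0) (fun x => Real.exp (-x) * x ^ (((k : ℝ) + 1) - 1)) := by
  funext x
  by_cases hx : 0 ≤ x
  · rw [Set.indicator_of_mem (by exact hx), gammaPDF, gammaPDFReal, if_pos hx,
      ENNReal.toReal_ofReal (by simp; positivity)]
    simp [mul_comm]
  · rw [Set.indicator_of_notMem (by exact hx), gammaPDF, gammaPDFReal, if_neg hx]
    simp

lemma aux_mom (k : ℕ) : Integrable (fun x : ℝ => x ^ k) (expMeasure 1) ∧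
    ∫ x, x ^ k ∂(expMeasure 1) = (Nat.factorial k : ℝ) := by
  have hm : Measurable (gammaPDF 1 1) := (measurable_gammaPDFReal 1 1).ennreal_ofReal
  have hl : ∀ᵐ x ∂(volume : Measure ℝ), gammaPDF 1 1 x < ∞ :=
    ae_of_all _ fun x => ENNReal.ofReal_lt_top
  have hk : (0 : ℝ) < (k : ℝ) + 1 := by positivity
  constructor
  · rw [expMeasure, gammaMeasure, integrable_withDensity_iff hm hl, aux_dens,
      integrable_indicator_iff measurableSet_Ici, integrableOn_Ici_iff_integrableOn_Ioi]
    exact Real.GammaIntegral_convergent hk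
  · rw [expMeasure, gammaMeasure, integral_withDensity_eq_integral_toReal_smul hm hl]
    simp_rw [smul_eq_mul, mul_comm _ (_ ^ k)]
    rw [aux_dens, integral_indicator measurableSet_Ici, integral_Ici_eq_integral_Ioi,
      ← Real.Gamma_eq_integral hk, Real.Gamma_nat_eq_factorial]

lemma aux_momE {Ω : Type*} [MeasurableSpace Ω] (P : Measure Ω) [IsProbabilityMeasure P]
    (E : Ω → ℝ) (h : IsExpOne P E) (k : ℕ) : Integrable (fun ω => E ω ^ k) P ∧
    ∫ ω, E ω ^ k ∂P = (Nat.factorial k : ℝ) := by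
  obtain ⟨hi, he⟩ := aux_mom k
  rw [← aux_map P E h] at hi he
  constructor
  · exact hi.comp_measurable h.1
  · rw [← he, integral_map h.1.aemeasurable (by fun_prop)]

lemma aux_pos {Ω : Type*} [MeasurableSpace Ω] (P : Measure Ω) [IsProbabilityMeasure P]
    (E : Ω → ℝ) (h : IsExpOne P E) : ∀ᵐ ω ∂P, 0 < E ω := by
  have h0 := h.2 0 le_rfl
  simp only [neg_zero, Real.exp_zero, ENNReal.ofReal_one] at h0
  exact (prob_compl_eq_zero_iff (measurableSet_lt measurable_const h.1)).2 h0

/-- for i.i.d. Exponential(1) random variables `E₁, E₂` and `ν ∈ ℕ`,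
`E[(E₁^{2ν+1} + E₂^{2ν+1}) / (E₁ + E₂)] = (2ν+1)!/(ν+1)`. -/
theorem exp_odd_power_ratio_integral
    {Ω : Type*} [MeasurableSpace Ω] (P : Measure Ω) [IsProbabilityMeasure P]
    (E₁ E₂ : Ω → ℝ) (h₁ : IsExpOne P E₁) (h₂ : IsExpOne P E₂)
    (hindep : IndepFun E₁ E₂ P) (ν : ℕ) :
    ∫ ω, (E₁ ω ^ (2 * ν + 1) + E₂ ω ^ (2 * ν + 1)) / (E₁ ω + E₂ ω) ∂P
      = (Nat.factorial (2 * ν + 1) : ℝ) / ((ν : ℝ) + 1) := by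
  have hae : (fun ω => (E₁ ω ^ (2 * ν + 1) + E₂ ω ^ (2 * ν + 1)) / (E₁ ω + E₂ ω)) =ᵐ[P]
      fun ω => ∑ k ∈ Finset.range (2 * ν + 1),
        (-1 : ℝ) ^ k * (E₁ ω ^ k * E₂ ω ^ (2 * ν - k)) := by
    filter_upwards [aux_pos P E₁ h₁, aux_pos P E₂ h₂] with ω p1 p2
    rw [div_eq_iff (by positivity)]
    have := geom_sum₂_mul (-E₁ ω) (E₂ ω) (2 * ν + 1)
    rw [Odd.neg_pow ⟨ν, rfl⟩] at this
    have e : ∀ k ∈ Finset.range (2 * ν + 1),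
        (-1 : ℝ) ^ k * (E₁ ω ^ k * E₂ ω ^ (2 * ν - k))
        = (-E₁ ω) ^ k * E₂ ω ^ (2 * ν + 1 - 1 - k) := by
      intro k _
      rw [neg_pow (E₁ ω) k, Nat.add_sub_cancel]
      ring
    rw [Finset.sum_congr rfl e]
    linear_combination this
  have hind : ∀ a b : ℕ, IndepFun (fun ω => E₁ ω ^ a) (fun ω => E₂ ω ^ b) P := fun a b =>
    hindep.comp (φ := fun x : ℝ => x ^ a) (ψ := fun x : ℝ => x ^ b) (by fun_prop) (by fun_prop)
  rw [integral_congr_ae hae, integral_finsetSum]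
  · have e : ∀ k ∈ Finset.range (2 * ν + 1),
        ∫ ω, (-1 : ℝ) ^ k * (E₁ ω ^ k * E₂ ω ^ (2 * ν - k)) ∂P
        = (-1 : ℝ) ^ k * ((Nat.factorial k : ℝ) * (Nat.factorial (2 * ν - k) : ℝ)) := by
      intro k _
      rw [integral_const_mul, (hind k (2 * ν - k)).integral_fun_mul_eq_mul_integral
        (aux_momE P E₁ h₁ _).1.1 (aux_momE P E₂ h₂ _).1.1,
        (aux_momE P E₁ h₁ _).2, (aux_momE P E₂ h₂ _).2]
    rw [Finset.sum_congr rfl e]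
    have hs := aux_sum (2 * ν)
    rw [Even.neg_one_pow ⟨ν, two_mul ν⟩] at hs
    push_cast at hs
    rw [eq_div_iff (by positivity)]
    linear_combination hs / 2
  · intro k _
    exact ((hind k (2 * ν - k)).integrable_mul
      (aux_momE P E₁ h₁ _).1 (aux_momE P E₂ h₂ _).1).const_mul _
end
end

section
/- For every real a > 0, ∫_0^∞ t² Γ(0, t) Γ(0, a t) dt = −(2a² + a + 2)/(3a²(a + 1)) + 2(a³ + 1) log(a + 1)/(3a³) − (2/3) log a, where Γ(0, x) = ∫_x^∞ e^{−u}/u du is the upper incomplete gamma function. -/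
open MeasureTheory ProbabilityTheory Filter
open scoped ENNReal NNReal Topology

noncomputable section

/-- The upper incomplete gamma function `Γ(0, x) = ∫_x^∞ e^{−u}/u du`. -/
def upperGammaZero (x : ℝ) : ℝ := ∫ u in Set.Ioi x, Real.exp (-u) / u

lemma ugz_intExp (x : ℝ) : IntegrableOn (fun u : ℝ => Real.exp (-u)) (Set.Ioi x) := by
  simpa using exp_neg_integrableOn_Ioi x one_pos

lemma ugz_le_aux {x u : ℝ} (hx : 0 < x) (hu : u ∈ Set.Ioi x) :
    Real.exp (-u) / u ≤ x⁻¹ * Real.exp (-u) := by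
  have hu' : x < u := hu
  have : u⁻¹ ≤ x⁻¹ := inv_anti₀ hx hu'.le
  rw [div_eq_mul_inv, mul_comm]
  exact mul_le_mul_of_nonneg_right this (Real.exp_pos _).le

lemma ugz_integrable {x : ℝ} (hx : 0 < x) :
    IntegrableOn (fun u : ℝ => Real.exp (-u) / u) (Set.Ioi x) := by
  refine Integrable.mono' ((ugz_intExp x).const_mul x⁻¹) ?_ ?_
  · exact (Measurable.div (by fun_prop) measurable_id).aestronglyMeasurable
  · filter_upwards [ae_restrict_mem measurableSet_Ioi] with u hu
    have hu' : 0 < u := hx.trans hu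
    rw [Real.norm_of_nonneg (by positivity)]
    exact ugz_le_aux hx hu

lemma ugz_nonneg {x : ℝ} (hx : 0 < x) : 0 ≤ upperGammaZero x := by
  refine setIntegral_nonneg measurableSet_Ioi fun u hu => ?_
  have hu' : 0 < u := hx.trans hu
  positivity

lemma ugz_le {x : ℝ} (hx : 0 < x) : upperGammaZero x ≤ x⁻¹ * Real.exp (-x) := by
  have h := setIntegral_mono_on (ugz_integrable hx) ((ugz_intExp x).const_mul x⁻¹)
    measurableSet_Ioi (fun u hu => ugz_le_aux hx hu)
  rw [integral_const_mul, integral_exp_neg_Ioi] at h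
  exact h

lemma ugz_le' {d t : ℝ} (hd : 0 < d) (ht : 0 < t) : t * upperGammaZero (d * t) ≤ d⁻¹ := by
  have h := ugz_le (mul_pos hd ht)
  have h1 : Real.exp (-(d * t)) ≤ 1 := Real.exp_le_one_iff.2 (by have := mul_pos hd ht; linarith)
  calc t * upperGammaZero (d * t) ≤ t * ((d * t)⁻¹ * Real.exp (-(d * t))) := by gcongr
    _ ≤ t * ((d * t)⁻¹ * 1) := by gcongr
    _ = d⁻¹ := by field_simp

lemma ugz_sub {x y : ℝ} (hx : 0 < x) (hxy : x ≤ y) :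
    upperGammaZero x - upperGammaZero y = ∫ u in x..y, Real.exp (-u) / u :=
  intervalIntegral.integral_Ioi_sub_Ioi (ugz_integrable hx) hxy

lemma ugz_hasDerivAt {x : ℝ} (hx : 0 < x) :
    HasDerivAt upperGammaZero (-(Real.exp (-x) / x)) x := by
  have hx2 : 0 < x / 2 := by linarith
  have hc : ContinuousOn (fun u : ℝ => Real.exp (-u) / u) (Set.Ioi 0) := by
    apply ContinuousOn.div
    · fun_prop
    · fun_prop
    · intro u hu; exact (ne_of_gt hu)
  have hnear : Set.Ioi (0:ℝ) ∈ 𝓝 x := Ioi_mem_nhds hx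
  have h := intervalIntegral.integral_hasDerivAt_right (f := fun u : ℝ => Real.exp (-u) / u)
    (a := x / 2) (b := x) ?_ (hc.stronglyMeasurableAtFilter isOpen_Ioi x hx)
    (hc.continuousAt hnear)
  · refine (h.const_sub (upperGammaZero (x / 2))).congr_of_eventuallyEq ?_
    filter_upwards [Ioi_mem_nhds (show x / 2 < x by linarith)] with y hy
    rw [← ugz_sub hx2 (le_of_lt hy)]
    ring
  · apply ContinuousOn.intervalIntegrable
    apply hc.mono
    intro u hu
    rw [Set.uIcc_of_le (by linarith)] at hu
    exact lt_of_lt_of_le hx2 hu.1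

lemma ugz_tendsto_atTop {d : ℝ} (hd : 0 < d) :
    Tendsto (fun t => upperGammaZero (d * t)) atTop (𝓝 0) := by
  have h : Tendsto (fun t : ℝ => d⁻¹ * t⁻¹) atTop (𝓝 0) := by
    simpa using tendsto_inv_atTop_zero.const_mul d⁻¹
  refine tendsto_of_tendsto_of_tendsto_of_le_of_le' tendsto_const_nhds h ?_ ?_
  · filter_upwards [eventually_gt_atTop 0] with t ht using ugz_nonneg (mul_pos hd ht)
  · filter_upwards [eventually_gt_atTop 0] with t ht
    have := ugz_le' hd ht
    rw [← div_eq_mul_inv, le_div_iff₀ ht]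
    linarith

lemma ugz_sub_tendsto {d c : ℝ} (hd : 0 < d) (hdc : d ≤ c) :
    Tendsto (fun t => upperGammaZero (d * t) - upperGammaZero (c * t)) (𝓝[>] 0)
      (𝓝 (Real.log (c / d))) := by
  have hc : 0 < c := hd.trans_le hdc
  have hl : ∀ e : ℝ, Tendsto (fun t : ℝ => Real.exp (-(e * t)) * Real.log (c / d)) (𝓝[>] 0)
      (𝓝 (Real.log (c / d))) := by
    intro e
    have : Continuous (fun t : ℝ => Real.exp (-(e * t)) * Real.log (c / d)) := by fun_prop
    have := this.tendsto 0
    simp only [mul_zero, neg_zero, Real.exp_zero, one_mul] at this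
    exact this.mono_left nhdsWithin_le_nhds
  have key : ∀ t : ℝ, 0 < t → ∀ e : ℝ,
      ∫ u in (d * t)..(c * t), Real.exp (-(e * t)) * u⁻¹
        = Real.exp (-(e * t)) * Real.log (c / d) := by
    intro t ht e
    rw [intervalIntegral.integral_const_mul, integral_inv_of_pos (by positivity) (by positivity),
      mul_div_mul_right _ _ ht.ne']
  have hii : ∀ t : ℝ, 0 < t → ∀ f : ℝ → ℝ, Continuous f →
      IntervalIntegrable (fun u => f u * u⁻¹) volume (d * t) (c * t) := by
    intro t ht f hf
    apply ContinuousOn.intervalIntegrable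
    apply hf.continuousOn.mul
    apply ContinuousOn.inv₀ continuousOn_id
    intro u hu
    rw [Set.uIcc_of_le (by gcongr)] at hu
    exact ne_of_gt (lt_of_lt_of_le (mul_pos hd ht) hu.1)
  refine tendsto_of_tendsto_of_tendsto_of_le_of_le' (hl c) (hl d) ?_ ?_
  · filter_upwards [self_mem_nhdsWithin] with t ht
    have ht : 0 < t := ht
    have hle : d * t ≤ c * t := by gcongr
    rw [ugz_sub (mul_pos hd ht) hle, ← key t ht c]
    simp only [div_eq_mul_inv]
    refine intervalIntegral.integral_mono_on hle (hii t ht _ (by fun_prop))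
      (hii t ht _ (by fun_prop)) fun u hu => ?_
    have : 0 < u := lt_of_lt_of_le (mul_pos hd ht) hu.1
    have := hu.2
    gcongr
  · filter_upwards [self_mem_nhdsWithin] with t ht
    have ht : 0 < t := ht
    have hle : d * t ≤ c * t := by gcongr
    rw [ugz_sub (mul_pos hd ht) hle, ← key t ht d]
    simp only [div_eq_mul_inv]
    refine intervalIntegral.integral_mono_on hle (hii t ht _ (by fun_prop))
      (hii t ht _ (by fun_prop)) fun u hu => ?_
    have : 0 < u := lt_of_lt_of_le (mul_pos hd ht) hu.1
    have := hu.1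
    gcongr

def ugzQ (b t : ℝ) : ℝ := -(t ^ 2 / b + 2 * t / b ^ 2 + 2 / b ^ 3) * Real.exp (-(b * t))

def ugzR (b c t : ℝ) : ℝ := ((t / b + 2 / b ^ 2) / c + 1 / (b * c ^ 2)) * Real.exp (-(c * t))

def ugzH (b d t : ℝ) : ℝ :=
  ugzQ b t * upperGammaZero (d * t) + 2 / b ^ 3 * upperGammaZero ((b + d) * t) + ugzR b (b + d) t

lemma ugz_exp_deriv (b t : ℝ) :
    HasDerivAt (fun t : ℝ => Real.exp (-(b * t))) (Real.exp (-(b * t)) * (-b)) t := by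
  have := ((hasDerivAt_id t).const_mul b).neg.exp
  simpa using this

lemma ugzQ_deriv {b : ℝ} (hb : 0 < b) (t : ℝ) :
    HasDerivAt (ugzQ b) (t ^ 2 * Real.exp (-(b * t))) t := by
  have h1 : HasDerivAt (fun t : ℝ => -(t ^ 2 / b + 2 * t / b ^ 2 + 2 / b ^ 3))
      (-(2 * t / b + 2 / b ^ 2)) t := by
    have := (((hasDerivAt_pow 2 t).div_const b).add
      (((hasDerivAt_id t).const_mul 2).div_const (b ^ 2))).add_const (2 / b ^ 3) |>.neg
    refine this.congr_deriv ?_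
    simp
  refine (h1.mul (ugz_exp_deriv b t)).congr_deriv ?_
  field_simp
  ring

lemma ugzR_deriv {b c : ℝ} (hb : 0 < b) (hc : 0 < c) (t : ℝ) :
    HasDerivAt (ugzR b c) (-(t / b + 2 / b ^ 2) * Real.exp (-(c * t))) t := by
  have h1 : HasDerivAt (fun t : ℝ => (t / b + 2 / b ^ 2) / c + 1 / (b * c ^ 2))
      (1 / b / c) t := by
    have := ((((hasDerivAt_id t).div_const b).add_const (2 / b ^ 2)).div_const c).add_const
      (1 / (b * c ^ 2))
    simpa using this
  refine (h1.mul (ugz_exp_deriv c t)).congr_deriv ?_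
  field_simp
  ring

lemma ugz_mul_deriv {d t : ℝ} (hd : 0 < d) (ht : 0 < t) :
    HasDerivAt (fun t => upperGammaZero (d * t)) (-(Real.exp (-(d * t)) / t)) t := by
  have h := (ugz_hasDerivAt (mul_pos hd ht)).comp t ((hasDerivAt_id t).const_mul d)
  refine h.congr_deriv ?_
  field_simp

lemma ugzH_deriv {b d t : ℝ} (hb : 0 < b) (hd : 0 < d) (ht : 0 < t) :
    HasDerivAt (ugzH b d) (t ^ 2 * Real.exp (-(b * t)) * upperGammaZero (d * t)) t := by
  have h := (((ugzQ_deriv hb t).mul (ugz_mul_deriv hd ht)).add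
    ((ugz_mul_deriv (add_pos hb hd) ht).const_mul (2 / b ^ 3))).add
    (ugzR_deriv hb (add_pos hb hd) t)
  refine h.congr_deriv ?_
  have : Real.exp (-((b + d) * t)) = Real.exp (-(b * t)) * Real.exp (-(d * t)) := by
    rw [← Real.exp_add]; ring_nf
  rw [this, ugzQ]
  field_simp
  ring

lemma ugz_powexp {b : ℝ} (hb : 0 < b) (n : ℕ) :
    Tendsto (fun t : ℝ => t ^ n * Real.exp (-(b * t))) atTop (𝓝 0) := by
  have h := ((Real.tendsto_pow_mul_exp_neg_atTop_nhds_zero n).comp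
    (tendsto_id.const_mul_atTop hb)).const_mul ((b ^ n)⁻¹)
  rw [mul_zero] at h
  refine h.congr fun t => ?_
  simp only [Function.comp, id, mul_pow]
  field_simp

lemma ugzQ_atTop {b : ℝ} (hb : 0 < b) : Tendsto (ugzQ b) atTop (𝓝 0) := by
  have h := (((ugz_powexp hb 2).const_mul (-(1 / b))).add
    ((ugz_powexp hb 1).const_mul (-(2 / b ^ 2)))).add ((ugz_powexp hb 0).const_mul (-(2 / b ^ 3)))
  simp only [mul_zero, add_zero] at h
  refine h.congr fun t => ?_
  rw [ugzQ]; ring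

lemma ugzR_atTop {b c : ℝ} (hc : 0 < c) : Tendsto (ugzR b c) atTop (𝓝 0) := by
  have h := ((ugz_powexp hc 1).const_mul (1 / b / c)).add
    ((ugz_powexp hc 0).const_mul (2 / b ^ 2 / c + 1 / (b * c ^ 2)))
  simp only [mul_zero, add_zero] at h
  refine h.congr fun t => ?_
  rw [ugzR]; ring

lemma ugzH_atTop {b d : ℝ} (hb : 0 < b) (hd : 0 < d) : Tendsto (ugzH b d) atTop (𝓝 0) := by
  have h := (((ugzQ_atTop hb).mul (ugz_tendsto_atTop hd)).add
    ((ugz_tendsto_atTop (add_pos hb hd)).const_mul (2 / b ^ 3))).add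
    (ugzR_atTop (b := b) (add_pos hb hd))
  simp only [mul_zero, add_zero] at h
  exact h

lemma ugzH_zero {b d : ℝ} (hb : 0 < b) (hd : 0 < d) :
    Tendsto (ugzH b d) (𝓝[>] 0)
      (𝓝 (-(2 / b ^ 3 * Real.log ((b + d) / d)) + (2 / b ^ 2 / (b + d) + 1 / (b * (b + d) ^ 2)))) := by
  have hslope : Tendsto (fun t : ℝ => t⁻¹ * (ugzQ b t + 2 / b ^ 3)) (𝓝[>] 0) (𝓝 0) := by
    have h := (hasDerivAt_iff_tendsto_slope.1 (ugzQ_deriv hb 0)).mono_left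
      (nhdsWithin_mono (0:ℝ) (fun t (ht : t ∈ Set.Ioi 0) => ne_of_gt ht))
    have h0 : ugzQ b 0 = -(2 / b ^ 3) := by simp [ugzQ]
    simpa [slope_fun_def, h0] using h
  have h1 : Tendsto (fun t : ℝ => (ugzQ b t + 2 / b ^ 3) * upperGammaZero (d * t))
      (𝓝[>] 0) (𝓝 0) := by
    have hb' := hslope.norm.mul_const d⁻¹
    rw [norm_zero, zero_mul] at hb'
    refine squeeze_zero_norm' ?_ hb'
    filter_upwards [self_mem_nhdsWithin] with t ht
    have ht : 0 < t := ht
    have e : (ugzQ b t + 2 / b ^ 3) * upperGammaZero (d * t)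
      = (t⁻¹ * (ugzQ b t + 2 / b ^ 3)) * (t * upperGammaZero (d * t)) := by
      field_simp
    rw [e, norm_mul]
    gcongr
    rw [Real.norm_of_nonneg (mul_nonneg ht.le (ugz_nonneg (mul_pos hd ht)))]
    exact ugz_le' hd ht
  have h2 := (ugz_sub_tendsto hd (by linarith : d ≤ b + d)).const_mul (-(2 / b ^ 3))
  have h3 : Tendsto (ugzR b (b + d)) (𝓝[>] 0) (𝓝 (ugzR b (b + d) 0)) :=
    (ugzR_deriv hb (add_pos hb hd) 0).continuousAt.tendsto.mono_left nhdsWithin_le_nhds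
  have h := (h1.add h2).add h3
  have e0 : ugzR b (b + d) 0 = 2 / b ^ 2 / (b + d) + 1 / (b * (b + d) ^ 2) := by simp [ugzR]
  rw [e0, zero_add, neg_mul] at h
  refine h.congr fun t => ?_
  rw [ugzH]; ring

lemma ugz_cube_bound {a t : ℝ} (ha : 0 < a) (ht : 0 < t) :
    t ^ 3 * upperGammaZero t * upperGammaZero (a * t) ≤ a⁻¹ * (t ^ 1 * Real.exp (-(1 * t))) := by
  have h1 := ugz_le ht
  have h2 := ugz_le' ha ht
  have n1 := ugz_nonneg ht
  have n2 := ugz_nonneg (mul_pos ha ht)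
  calc t ^ 3 * upperGammaZero t * upperGammaZero (a * t)
      = t ^ 2 * upperGammaZero t * (t * upperGammaZero (a * t)) := by ring
    _ ≤ t ^ 2 * (t⁻¹ * Real.exp (-t)) * a⁻¹ := by gcongr
    _ = _ := by rw [one_mul]; field_simp

lemma ugz_cube_nonneg {a t : ℝ} (ha : 0 < a) (ht : 0 < t) :
    0 ≤ t ^ 3 * upperGammaZero t * upperGammaZero (a * t) := by
  have n1 := ugz_nonneg ht
  have n2 := ugz_nonneg (mul_pos ha ht)
  positivity

def ugzF (a t : ℝ) : ℝ :=
  1 / 3 * (t ^ 3 * upperGammaZero t * upperGammaZero (a * t) + ugzH 1 a t + ugzH a 1 t)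

lemma ugzF_deriv {a t : ℝ} (ha : 0 < a) (ht : 0 < t) :
    HasDerivAt (ugzF a) (t ^ 2 * upperGammaZero t * upperGammaZero (a * t)) t := by
  have h := (((((hasDerivAt_pow 3 t).mul (ugz_hasDerivAt ht)).mul (ugz_mul_deriv ha ht)).add
    (ugzH_deriv one_pos ha ht)).add (ugzH_deriv ha one_pos ht)).const_mul (1 / 3)
  refine h.congr_deriv ?_
  simp only [one_mul, Pi.mul_apply]
  push_cast
  field_simp
  ring

/-- for every `a > 0`,
`∫_0^∞ t² Γ(0,t) Γ(0,at) dt = −(2a²+a+2)/(3a²(a+1)) + 2(a³+1)log(a+1)/(3a³) − (2/3)log a`. -/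
theorem integral_sq_upperGammaZero (a : ℝ) (ha : 0 < a) :
    ∫ t in Set.Ioi (0:ℝ), t ^ 2 * upperGammaZero t * upperGammaZero (a * t)
      = -(2 * a ^ 2 + a + 2) / (3 * a ^ 2 * (a + 1))
        + 2 * (a ^ 3 + 1) * Real.log (a + 1) / (3 * a ^ 3)
        - (2 / 3) * Real.log a := by
  have hTop : Tendsto (ugzF a) atTop (𝓝 0) := by
    have h0 : Tendsto (fun t => t ^ 3 * upperGammaZero t * upperGammaZero (a * t)) atTop (𝓝 0) := by
      have hb := (ugz_powexp one_pos 1).const_mul a⁻¹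
      rw [mul_zero] at hb
      refine tendsto_of_tendsto_of_tendsto_of_le_of_le' tendsto_const_nhds hb ?_ ?_
      · filter_upwards [eventually_gt_atTop 0] with t ht using ugz_cube_nonneg ha ht
      · filter_upwards [eventually_gt_atTop 0] with t ht using ugz_cube_bound ha ht
    have h := ((h0.add (ugzH_atTop one_pos ha)).add (ugzH_atTop ha one_pos)).const_mul (1 / 3)
    simp only [mul_zero, add_zero] at h
    exact h
  have hZero : ∃ L, L = (1 / 3) * (0 + (-(2 / 1 ^ 3 * Real.log ((1 + a) / a))
        + (2 / 1 ^ 2 / (1 + a) + 1 / (1 * (1 + a) ^ 2)))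
      + (-(2 / a ^ 3 * Real.log ((a + 1) / 1)) + (2 / a ^ 2 / (a + 1) + 1 / (a * (a + 1) ^ 2))))
      ∧ Tendsto (ugzF a) (𝓝[>] 0) (𝓝 L) := by
    refine ⟨_, rfl, ?_⟩
    have h0 : Tendsto (fun t => t ^ 3 * upperGammaZero t * upperGammaZero (a * t))
        (𝓝[>] 0) (𝓝 0) := by
      have hb : Tendsto (fun t : ℝ => a⁻¹ * (t ^ 1 * Real.exp (-(1 * t)))) (𝓝[>] 0) (𝓝 0) := by
        have : Continuous (fun t : ℝ => a⁻¹ * (t ^ 1 * Real.exp (-(1 * t)))) := by fun_prop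
        have := this.tendsto 0
        simp only [pow_one, zero_mul, mul_zero] at this
        simp only [pow_one]
        exact this.mono_left nhdsWithin_le_nhds
      refine tendsto_of_tendsto_of_tendsto_of_le_of_le' tendsto_const_nhds hb ?_ ?_
      · filter_upwards [self_mem_nhdsWithin] with t ht using ugz_cube_nonneg ha ht
      · filter_upwards [self_mem_nhdsWithin] with t ht using ugz_cube_bound ha ht
    exact ((h0.add (ugzH_zero one_pos ha)).add (ugzH_zero ha one_pos)).const_mul (1 / 3)
  obtain ⟨L, hL, hT⟩ := hZero
  have hmain : ∫ t in Set.Ioi (0:ℝ), t ^ 2 * upperGammaZero t * upperGammaZero (a * t)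
      = 0 - Function.update (ugzF a) 0 L 0 := by
    refine integral_Ioi_of_hasDerivAt_of_nonneg ?_ ?_ ?_ ?_
    · rw [continuousWithinAt_update_same]
      simpa using hT
    · intro t ht
      refine (ugzF_deriv ha ht).congr_of_eventuallyEq ?_
      filter_upwards [Ioi_mem_nhds (show (0:ℝ) < t from ht)] with y hy
      exact Function.update_of_ne (ne_of_gt hy) _ _
    · intro t ht
      have ht : 0 < t := ht
      have n1 := ugz_nonneg ht
      have n2 := ugz_nonneg (mul_pos ha ht)
      positivity
    · refine hTop.congr' ?_
      filter_upwards [eventually_gt_atTop 0] with t ht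
      exact (Function.update_of_ne (ne_of_gt ht) _ _).symm
  have ha1 : a + 1 ≠ 0 := by positivity
  rw [hmain, Function.update_self, hL, add_comm 1 a, Real.log_div ha1 ha.ne', div_one]
  field_simp
  ring
end
end
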